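/- arXiv:2510.06581 — 2 statements merged into one kernel-verified Lean document; each statement's English description precedes it below -/
import Mathlib

section
/- For every chore instance I = (N, M, w, v) there exist a finite set M' of items with M ⊆ M' and additive cost functions v' on M' extending v (i.e., v'_i(e) = v_i(e) for all agents i and all e ∈ M) such that for every agent i: the weighted maximin share of i in the new instance I' = (N, M', w, v') equals her weighted maximin share in I, and moreover WMMS_i(I') = w_i · v'_i(M') / (Σ_{j∈[n]} w_j). -/
open Finset

namespace Chores

/-- The cost incurred by agent `j` under the assignment `f` of items to agents
(item `e` is given to agent `f e`); ordered partitions of the item set into `n`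
(possibly empty) bundles correspond exactly to such assignments. -/
noncomputable def cost {ι : Type*} [Fintype ι] {n : ℕ} (v : ι → ℝ) (f : ι → Fin n)
    (j : Fin n) : ℝ :=
  ∑ e ∈ univ.filter (fun e => f e = j), v e

/-- The weighted maximin share of agent `i`, where `w` is the weight vector and
`v` is agent `i`'s own (additive) item cost function:
`WMMS_i = w_i * min over allocations (B_1,…,B_n) of max_j v_i(B_j)/w_j`. -/
noncomputable def WMMS {ι : Type*} [Fintype ι] {n : ℕ} (w : Fin n → ℝ) (v : ι → ℝ)
    (i : Fin n) : ℝ :=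
  w i * ⨅ f : ι → Fin n, ⨆ j : Fin n, cost v f j / w j

/-- A chore instance: every agent has a positive weight and nonnegative item costs. -/
def ChoreInstance {ι : Type*} {n : ℕ} (w : Fin n → ℝ) (v : Fin n → ι → ℝ) : Prop :=
  (∀ i, 0 < w i) ∧ ∀ i e, 0 ≤ v i e

/-- The bundle costs of an allocation add up to the total cost of all items. -/
lemma sum_cost {ι : Type*} [Fintype ι] {n : ℕ} (v : ι → ℝ) (f : ι → Fin n) :
    ∑ j, cost v f j = ∑ e, v e :=
  Finset.sum_fiberwise univ f v

lemma cost_le_mul_iSup {ι : Type*} [Fintype ι] {n : ℕ} {w : Fin n → ℝ} (hw : ∀ j, 0 < w j)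
    (v : ι → ℝ) (f : ι → Fin n) (j : Fin n) :
    cost v f j ≤ w j * ⨆ k, cost v f k / w k := by
  have h := le_ciSup (Set.finite_range fun k => cost v f k / w k).bddAbove j
  rw [div_le_iff₀ (hw j)] at h
  linarith

/-- The largest weighted bundle cost is at least the proportional cost. -/
lemma sum_div_sum_le_iSup {ι : Type*} [Fintype ι] {n : ℕ} [NeZero n] {w : Fin n → ℝ}
    (hw : ∀ j, 0 < w j) (v : ι → ℝ) (f : ι → Fin n) :
    (∑ e, v e) / ∑ j, w j ≤ ⨆ j, cost v f j / w j := by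
  rw [div_le_iff₀ (sum_pos (fun j _ => hw j) univ_nonempty), ← sum_cost v f, mul_comm, sum_mul]
  exact sum_le_sum fun j _ => cost_le_mul_iSup hw v f j

/-- If some allocation gives all agents the same weighted cost `X`, then `X` is the
min-max weighted cost and is equal to the proportional cost. -/
lemma iInf_iSup_eq_of_balanced {ι : Type*} [Fintype ι] {n : ℕ} [NeZero n] {w : Fin n → ℝ}
    (hw : ∀ j, 0 < w j) {v : ι → ℝ} {f : ι → Fin n} {X : ℝ} (hf : ∀ j, cost v f j = w j * X) :
    (⨅ g : ι → Fin n, ⨆ j, cost v g j / w j) = X ∧ X = (∑ e, v e) / ∑ j, w j := by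
  have hX : X = (∑ e, v e) / ∑ j, w j := by
    rw [eq_div_iff (sum_pos (fun j _ => hw j) univ_nonempty).ne', ← sum_cost v f, mul_comm,
      sum_mul]
    simp only [hf]
  refine ⟨le_antisymm ?_ (le_ciInf fun g => hX ▸ sum_div_sum_le_iSup hw v g), hX⟩
  refine ciInf_le_of_le (Set.finite_range _).bddBelow f (ciSup_le fun j => ?_)
  rw [hf, mul_div_cancel_left₀ _ (hw j).ne']

/-- Adding one extra item per agent, given to that agent, adds its cost to her bundle. -/
lemma cost_sumElim_id {ι : Type*} [Fintype ι] {n : ℕ} (v : ι → ℝ) (u : Fin n → ℝ)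
    (f : ι → Fin n) (j : Fin n) :
    cost (Sum.elim v u) (Sum.elim f id) j = cost v f j + u j := by
  simp only [cost, sum_filter, Fintype.sum_sum_type]
  exact congrArg _ (Fintype.sum_ite_eq' j u)

/-- A single cost function can be padded with `n` items so that the WMMS is unchanged and
becomes proportional. -/
lemma exists_padding {ι : Type*} [Fintype ι] {n : ℕ} {w : Fin n → ℝ} (hw : ∀ j, 0 < w j)
    (v : ι → ℝ) (i : Fin n) :
    ∃ u : Fin n → ℝ, (∀ j, 0 ≤ u j) ∧ WMMS w (Sum.elim v u) i = WMMS w v i ∧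
      WMMS w (Sum.elim v u) i = w i * (∑ e, Sum.elim v u e) / ∑ j, w j := by
  have : NeZero n := ⟨i.pos.ne'⟩
  obtain ⟨f, hf⟩ := exists_eq_ciInf_of_finite (f := fun f : ι → Fin n => ⨆ j, cost v f j / w j)
  set X := ⨅ f : ι → Fin n, ⨆ j, cost v f j / w j
  have hbal : ∀ j, cost (Sum.elim v fun k => w k * X - cost v f k) (Sum.elim f id) j
      = w j * X := fun j => by rw [cost_sumElim_id]; ring
  obtain ⟨h₁, h₂⟩ := iInf_iSup_eq_of_balanced hw hbal
  refine ⟨fun k => w k * X - cost v f k, fun j => ?_, ?_, ?_⟩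
  · rw [sub_nonneg, ← hf]
    exact cost_le_mul_iSup hw v f j
  · rw [WMMS, WMMS, h₁]
  · rw [WMMS, h₁, mul_div_assoc, ← h₂]

/-- For every chore instance `I = (N, M, w, v)` there is a finite
superset of items `M' = M ⊕ M²` (adding `m₂` auxiliary items) and nonnegative
additive cost functions `v'` extending `v` such that for every agent `i` the WMMS
in the new instance equals the WMMS in `I`, and moreover
`WMMS_i(I') = w_i · v'_i(M') / (Σ_j w_j)`. -/
theorem pad_to_proportional_WMMS {n m : ℕ} (w : Fin n → ℝ) (v : Fin n → Fin m → ℝ)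
    (hI : ChoreInstance w v) :
    ∃ (m₂ : ℕ) (v' : Fin n → (Fin m ⊕ Fin m₂) → ℝ),
      ChoreInstance w v' ∧
      (∀ i (e : Fin m), v' i (Sum.inl e) = v i e) ∧
      (∀ i : Fin n, WMMS w (v' i) i = WMMS w (v i) i) ∧
      (∀ i : Fin n, WMMS w (v' i) i = w i * (∑ e, v' i e) / (∑ j, w j)) := by
  choose u hu hW hP using fun i => exists_padding hI.1 (v i) i
  refine ⟨n, fun i => Sum.elim (v i) (u i), ⟨hI.1, fun i e => ?_⟩, fun _ _ => rfl, hW, hP⟩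
  cases e with
  | inl e => exact hI.2 i e
  | inr j => exact hu i j

end Chores
end

section
/- In any chore instance, the agent with the largest weight values every single item at most her weighted maximin share: if agent i satisfies w_i ≥ w_j for all j ∈ [n], then v_i(e) ≤ WMMS_i for every item e ∈ M. More generally, for every agent i and every item e ∈ M, v_i(e) ≤ (max_{j∈[n]} w_j / w_i)·WMMS_i. -/
open Finset

namespace Chores

/-- An item costs at most the cost of the bundle containing it. -/
theorem le_cost_apply {ι : Type*} [Fintype ι] {n : ℕ} {v : ι → ℝ} (hv : ∀ e, 0 ≤ v e)
    (f : ι → Fin n) (e : ι) : v e ≤ cost v f (f e) :=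
  single_le_sum (f := v) (fun a _ => hv a) (by simp)

/-- If `c` bounds all weights, every item costs at most `c` times the min-max weighted
bundle cost. -/
theorem le_mul_iInf_iSup_cost_div {ι : Type*} [Fintype ι] {n : ℕ} {w : Fin n → ℝ} {v : ι → ℝ}
    (hw : ∀ j, 0 < w j) (hv : ∀ e, 0 ≤ v e) [Nonempty (Fin n)] {c : ℝ} (hc : ∀ j, w j ≤ c)
    (e : ι) : v e ≤ c * ⨅ f : ι → Fin n, ⨆ j : Fin n, cost v f j / w j := by
  have hc0 : 0 < c := (hw (Classical.arbitrary _)).trans_le (hc _)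
  rw [← div_le_iff₀' hc0]
  refine le_ciInf fun f => ?_
  calc v e / c ≤ cost v f (f e) / w (f e) :=
        div_le_div₀ ((hv e).trans (le_cost_apply hv f e)) (le_cost_apply hv f e) (hw _) (hc _)
    _ ≤ ⨆ j, cost v f j / w j :=
        le_ciSup (f := fun j => cost v f j / w j) (Set.finite_range _).bddAbove (f e)

/-- In any chore instance, the agent with the largest weight
values every single item at most her weighted maximin share: if `w_i ≥ w_j` for
all `j`, then `v_i(e) ≤ WMMS_i` for every item `e`. More generally, for every
agent `i` and every item `e`, `v_i(e) ≤ ((max_j w_j)/w_i)·WMMS_i`. -/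
theorem single_item_le_WMMS {n m : ℕ} (w : Fin n → ℝ) (v : Fin n → Fin m → ℝ)
    (hI : ChoreInstance w v) :
    (∀ i : Fin n, (∀ j, w j ≤ w i) → ∀ e : Fin m, v i e ≤ WMMS w (v i) i) ∧
    (∀ (i : Fin n) (e : Fin m),
      v i e ≤ ((⨆ j : Fin n, w j) / w i) * WMMS w (v i) i) := by
  refine ⟨fun i hi e => ?_, fun i e => ?_⟩
  · have : Nonempty (Fin n) := ⟨i⟩
    exact le_mul_iInf_iSup_cost_div hI.1 (hI.2 i) hi e
  · have : Nonempty (Fin n) := ⟨i⟩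
    rw [WMMS, ← mul_assoc, div_mul_cancel₀ _ (hI.1 i).ne']
    exact le_mul_iInf_iSup_cost_div hI.1 (hI.2 i) (le_ciSup (Set.finite_range w).bddAbove) e

end Chores
end
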